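/- Let q = r^2 with r ≡ 3 (mod 4). Suppose a, b are even divisors of q-1 with b ≡ 2 (mod 4), 2a | b(r+1), and 2b | a(r-1). If 1 ≤ s ≤ a/gcd(a,b), 1 ≤ t ≤ b/gcd(a,b), and (r+1)b s²/(2a) is odd, then there exists a q-ary MDS Euclidean self-dual code of length n = s(q-1)/a + t(q-1)/b. -/

import Mathlib

open Finset

variable {F : Type*} [Field F]

/-- `δ_A(aᵢ)` for a listed set `a : Fin n → F`. -/
noncomputable def delta {n : ℕ} (a : Fin n → F) (i : Fin n) : F :=
  ∏ j ∈ Finset.univ.erase i, (a i - a j)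

/-- `δ_S(x)` for a finite set `S ⊆ F`. -/
noncomputable def deltaSet [DecidableEq F] (S : Finset F) (x : F) : F :=
  ∏ y ∈ S.erase x, (x - y)

/-- Euclidean dual of a linear code. -/
def dualCode {n : ℕ} (C : Submodule F (Fin n → F)) : Submodule F (Fin n → F) where
  carrier := {x | ∀ y ∈ C, ∑ i, x i * y i = 0}
  add_mem' := by
    intro x y hx hy z hz
    simp [add_mul, Finset.sum_add_distrib, hx z hz, hy z hz]
  zero_mem' := by intro y hy; simp
  smul_mem' := by
    intro c x hx y hy
    simp [smul_eq_mul, mul_assoc, ← Finset.mul_sum, hx y hy]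

/-- Hamming weight. -/
noncomputable def wt {n : ℕ} (c : Fin n → F) : ℕ := Nat.card {i // c i ≠ 0}

/-- `C` is an `[n, k, n-k+1]` MDS code. -/
noncomputable def IsMDSCode {n : ℕ} (C : Submodule F (Fin n → F)) (k : ℕ) : Prop :=
  Module.finrank F C = k ∧ ∀ c ∈ C, c ≠ 0 → n - k + 1 ≤ wt c

noncomputable def GRSmap {n : ℕ} (a v : Fin n → F) : Polynomial F →ₗ[F] (Fin n → F) where
  toFun f := fun i => v i * Polynomial.eval (a i) f
  map_add' f g := by funext i; simp [mul_add]
  map_smul' c f := by funext i; simp [Polynomial.eval_smul]; ring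

/-- Generalized Reed–Solomon code `GRS_k(A, v)`. -/
noncomputable def GRS {n : ℕ} (k : ℕ) (a v : Fin n → F) : Submodule F (Fin n → F) :=
  Submodule.map (GRSmap a v) (Polynomial.degreeLT F k)

noncomputable def GRSextMap {n : ℕ} (k : ℕ) (a v : Fin n → F) :
    Polynomial F →ₗ[F] (Fin (n+1) → F) where
  toFun f := fun i =>
    if h : (i : ℕ) < n then v ⟨i, h⟩ * Polynomial.eval (a ⟨i, h⟩) f else f.coeff (k - 1)
  map_add' f g := by
    funext i
    by_cases h : (i : ℕ) < n <;> simp [h, mul_add]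
  map_smul' c f := by
    funext i
    by_cases h : (i : ℕ) < n <;> simp [h, Polynomial.eval_smul] <;> ring

/-- Extended generalized Reed–Solomon code `GRS_k(A ∪ {∞}, v)`. -/
noncomputable def GRSext {n : ℕ} (k : ℕ) (a v : Fin n → F) : Submodule F (Fin (n+1) → F) :=
  Submodule.map (GRSextMap k a v) (Polynomial.degreeLT F k)

open Polynomial in
/-- A nonzero polynomial of degree `< k` has weight at least `n - k + 1` in a GRS code. -/
theorem le_wt_GRSmap {n k : ℕ} {a w : Fin n → F} (ha : Function.Injective a) (hw : ∀ i, w i ≠ 0)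
    {f : F[X]} (hf : f ∈ degreeLT F k) (hf0 : f ≠ 0) : n + 1 ≤ wt (GRSmap a w f) + k := by
  classical
  have hz : (univ.filter fun i => f.eval (a i) = 0).card < k := by
    by_contra! h
    refine hf0 (eq_zero_of_degree_lt_of_eval_index_eq_zero
      (s := univ.filter fun i => f.eval (a i) = 0) (v := a) ha.injOn ?_ (by simp))
    exact (mem_degreeLT.1 hf).trans_le (by exact_mod_cast h)
  have hwt : wt (GRSmap a w f) = (univ.filter fun i => ¬ f.eval (a i) = 0).card := by
    rw [wt, Nat.card_eq_fintype_card, Fintype.card_subtype]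
    congr 1
    ext i
    simp [GRSmap, hw]
  have := card_filter_add_card_filter_not (s := (univ : Finset (Fin n)))
    (fun i => f.eval (a i) = 0)
  simp only [card_univ, Fintype.card_fin] at this
  omega

open Polynomial in
theorem finrank_GRS {n k : ℕ} {a w : Fin n → F} (ha : Function.Injective a) (hw : ∀ i, w i ≠ 0)
    (hk : k ≤ n) : Module.finrank F (GRS k a w) = k := by
  have hinj : Function.Injective ((GRSmap a w).domRestrict (degreeLT F k)) := by
    rw [← LinearMap.ker_eq_bot, LinearMap.ker_eq_bot']
    rintro ⟨f, hf⟩ h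
    by_contra h0
    have h1 := le_wt_GRSmap ha hw hf (fun h => h0 (Subtype.ext h))
    rw [LinearMap.domRestrict_apply] at h
    simp only [h, wt, Pi.zero_apply, ne_eq, not_true_eq_false, Nat.card_of_isEmpty] at h1
    omega
  rw [GRS, ← LinearMap.range_domRestrict, LinearMap.finrank_range_of_inj hinj,
    (degreeLTEquiv F k).finrank_eq, Module.finrank_fin_fun]

theorem isMDSCode_GRS {n k : ℕ} {a w : Fin n → F} (ha : Function.Injective a)
    (hw : ∀ i, w i ≠ 0) (hk : k ≤ n) : IsMDSCode (GRS k a w) k := by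
  refine ⟨finrank_GRS ha hw hk, ?_⟩
  rintro _ ⟨f, hf, rfl⟩ hc
  have := le_wt_GRSmap ha hw hf (fun h => hc (by rw [h, map_zero]))
  omega

theorem finrank_dualCode {n : ℕ} (C : Submodule F (Fin n → F)) :
    Module.finrank F C + Module.finrank F (dualCode C) = n := by
  have h : dualCode C = C.dualAnnihilator.comap (dotProductEquiv F (Fin n)).toLinearMap := by
    ext x
    simp [dualCode, Submodule.mem_dualAnnihilator, dotProduct]
  have h2 := Subspace.finrank_add_finrank_dualAnnihilator_eq C
  rw [Module.finrank_fin_fun] at h2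
  rw [h, LinearEquiv.finrank_eq
    ((dotProductEquiv F (Fin n)).ofSubmodule' C.dualAnnihilator), h2]

open Polynomial in
theorem GRS_eq_dualCode {k : ℕ} {a w : Fin (2 * k) → F} (ha : Function.Injective a)
    (hw : ∀ i, w i ^ 2 * delta a i = 1) : GRS k a w = dualCode (GRS k a w) := by
  have hw0 : ∀ i, w i ≠ 0 := fun i h => by simpa [h] using hw i
  refine Submodule.eq_of_le_of_finrank_eq ?_ ?_
  · rintro _ ⟨f, hf, rfl⟩ _ ⟨g, hg, rfl⟩
    rcases eq_or_ne (f * g) 0 with h0 | h0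
    · refine sum_eq_zero fun i _ => ?_
      have : f.eval (a i) * g.eval (a i) = 0 := by rw [← eval_mul, h0, eval_zero]
      simp only [GRSmap, LinearMap.coe_mk, AddHom.coe_mk]
      linear_combination (w i * w i) * this
    have hf0 := left_ne_zero_of_mul h0
    have hg0 := right_ne_zero_of_mul h0
    have hfd := (natDegree_lt_iff_degree_lt hf0).2 (mem_degreeLT.1 hf)
    have hgd := (natDegree_lt_iff_degree_lt hg0).2 (mem_degreeLT.1 hg)
    have hd := natDegree_mul hf0 hg0
    have hdeg : (f * g).degree < (univ : Finset (Fin (2 * k))).card := by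
      rw [← natDegree_lt_iff_degree_lt h0, card_univ, Fintype.card_fin]
      omega
    have hsum := Lagrange.coeff_eq_sum ha.injOn hdeg
    rw [coeff_eq_zero_of_natDegree_lt (by rw [card_univ, Fintype.card_fin]; omega)] at hsum
    rw [hsum]
    refine sum_congr rfl fun i _ => ?_
    have hi := hw i
    rw [delta] at hi
    rw [eq_div_iff (right_ne_zero_of_mul_eq_one hi)]
    simp only [GRSmap, LinearMap.coe_mk, AddHom.coe_mk, eval_mul]
    linear_combination f.eval (a i) * g.eval (a i) * hi
  · have h1 := finrank_GRS ha hw0 (k := k) (by omega)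
    have h2 := finrank_dualCode (GRS k a w)
    omega

/-- An evaluation set all of whose `δ`-values are nonzero squares carries an MDS self-dual code. -/
theorem exists_selfDual_of_isSquare {ι : Type*} [Fintype ι] {n : ℕ}
    (hcard : Fintype.card ι = n) (hn : Even n) (v : ι → F)
    (hv : ∀ i, ∃ z ≠ 0, (Polynomial.derivative (Lagrange.nodal univ v)).eval (v i) = z ^ 2) :
    ∃ C : Submodule F (Fin n → F), IsMDSCode C (n / 2) ∧ C = dualCode C := by
  classical
  obtain ⟨k, rfl⟩ := even_iff_two_dvd.1 hn
  let e : Fin (2 * k) ≃ ι := (finCongr hcard.symm).trans (Fintype.equivFin ι).symm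
  have hnodal : Lagrange.nodal univ (v ∘ e) = Lagrange.nodal univ v := by
    simp only [Lagrange.nodal, Function.comp_apply]
    exact e.prod_comp fun j => Polynomial.X - Polynomial.C (v j)
  choose z hz0 hz using hv
  have hdelta : ∀ i, delta (v ∘ e) i = z (e i) ^ 2 := fun i => by
    rw [delta, ← hz, ← hnodal]
    exact (Lagrange.eval_nodal_derivative_eval_node_eq (v := v ∘ e) (mem_univ i)).trans
      Lagrange.eval_nodal |>.symm
  have hinj : Function.Injective (v ∘ e) := by
    intro i j hij
    by_contra hne
    refine pow_ne_zero 2 (hz0 (e i)) ((hdelta i).symm.trans ?_)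
    exact prod_eq_zero (mem_erase.2 ⟨Ne.symm hne, mem_univ j⟩) (sub_eq_zero.2 hij)
  have hw : ∀ i, ((z (e i))⁻¹) ^ 2 * delta (v ∘ e) i = 1 := fun i => by
    rw [hdelta, ← mul_pow, inv_mul_cancel₀ (hz0 _), one_pow]
  refine ⟨GRS k (v ∘ e) fun i => (z (e i))⁻¹, ?_, GRS_eq_dualCode hinj hw⟩
  rw [Nat.mul_div_cancel_left k two_pos]
  exact isMDSCode_GRS hinj (fun i => inv_ne_zero (hz0 _)) (by omega)

open Polynomial in
theorem eval_derivative_prod_X_pow_sub_C {s e : ℕ} (c : Fin s → F) {x : F} {i : Fin s}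
    (hx : x ^ e = c i) :
    (derivative (∏ j, (X ^ e - C (c j)))).eval x
      = e * x ^ (e - 1) * ∏ j ∈ univ.erase i, (c i - c j) := by
  have h : ∏ j, (X ^ e - C (c j)) = (Lagrange.nodal univ c).comp (X ^ e) := by
    simp [Lagrange.nodal, Polynomial.prod_comp]
  rw [h, derivative_comp, eval_mul, eval_comp, eval_pow, eval_X, hx,
    Lagrange.eval_nodal_derivative_eval_node_eq (mem_univ i), Lagrange.eval_nodal]
  rw [derivative_X_pow, eval_mul, eval_C, eval_pow, eval_X]

/-- The `s` cosets `α i * ⟨ζ⟩` followed by the `t` cosets `β j * ⟨ξ⟩`. -/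
def cosetPoints {s e t f : ℕ} (ζ ξ : F) (α : Fin s → F) (β : Fin t → F) :
    (Fin s × Fin e) ⊕ (Fin t × Fin f) → F :=
  Sum.elim (fun p => ζ ^ (p.2 : ℕ) * α p.1) (fun p => ξ ^ (p.2 : ℕ) * β p.1)

open Polynomial in
theorem nodal_cosetPoints {s e t f : ℕ} {ζ ξ : F} (hζ : IsPrimitiveRoot ζ e)
    (hξ : IsPrimitiveRoot ξ f) (he : 0 < e) (hf : 0 < f) (α : Fin s → F) (β : Fin t → F) :
    Lagrange.nodal univ (cosetPoints (e := e) (f := f) ζ ξ α β)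
      = (∏ i, (X ^ e - C (α i ^ e))) * ∏ j, (X ^ f - C (β j ^ f)) := by
  simp only [Lagrange.nodal, cosetPoints, Fintype.prod_sum_type, Fintype.prod_prod_type,
    Sum.elim_inl, Sum.elim_inr]
  congr 1 <;> refine prod_congr rfl fun i _ => ?_
  · rw [X_pow_sub_C_eq_prod hζ he rfl, prod_range]
  · rw [X_pow_sub_C_eq_prod hξ hf rfl, prod_range]

theorem exists_selfDual_of_cosets [Fintype F] [DecidableEq F] {s e t f : ℕ} {ζ ξ : F}
    (hζ : IsPrimitiveRoot ζ e) (hξ : IsPrimitiveRoot ξ f) (he : 0 < e) (hf : 0 < f)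
    (heven : Even e) (hfeven : Even f) (hs : Odd s) (α : Fin s → F) (β : Fin t → F)
    (hχe : quadraticChar F e = 1) (hχf : quadraticChar F f = 1)
    (hχζ : quadraticChar F ζ = 1) (hχξ : quadraticChar F ξ = 1)
    (hχα : ∀ i, quadraticChar F (α i) = 1) (hχβ : ∀ j, quadraticChar F (β j) = -1)
    (hαα : ∀ i j, i ≠ j → quadraticChar F (α i ^ e - α j ^ e) = 1)
    (hββ : ∀ i j, i ≠ j → quadraticChar F (β i ^ f - β j ^ f) = 1)
    (hαβ : ∀ i (k : ℕ) j, quadraticChar F ((ζ ^ k * α i) ^ f - β j ^ f) = 1)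
    (hβα : ∀ j (k : ℕ) i, quadraticChar F ((ξ ^ k * β j) ^ e - α i ^ e) = -1) :
    ∃ C : Submodule F (Fin (s * e + t * f) → F),
      IsMDSCode C ((s * e + t * f) / 2) ∧ C = dualCode C := by
  refine exists_selfDual_of_isSquare (by simp) ((heven.mul_left s).add (hfeven.mul_left t))
    (cosetPoints (e := e) (f := f) ζ ξ α β) fun p => ?_
  suffices h : quadraticChar F ((Polynomial.derivative (Lagrange.nodal univ
      (cosetPoints (e := e) (f := f) ζ ξ α β))).eval (cosetPoints ζ ξ α β p)) = 1 by
    have h0 : (Polynomial.derivative (Lagrange.nodal univ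
      (cosetPoints (e := e) (f := f) ζ ξ α β))).eval (cosetPoints ζ ξ α β p) ≠ 0 := by
      intro h0
      simp [h0] at h
    obtain ⟨z, hz⟩ := (quadraticChar_one_iff_isSquare h0).1 h
    exact ⟨z, fun hz0 => h0 (by rw [hz, hz0, mul_zero]), by rw [hz, sq]⟩
  rw [nodal_cosetPoints hζ hξ he hf, Polynomial.derivative_mul, Polynomial.eval_add,
    Polynomial.eval_mul, Polynomial.eval_mul]
  rcases p with ⟨i, k⟩ | ⟨j, k⟩
  · have hx : (ζ ^ (k : ℕ) * α i) ^ e = α i ^ e := by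
      rw [mul_pow, pow_right_comm, hζ.pow_eq_one, one_pow, one_mul]
    have h0 : (∏ i, (Polynomial.X ^ e - Polynomial.C (α i ^ e))).eval (ζ ^ (k : ℕ) * α i) = 0 := by
      rw [Polynomial.eval_prod]
      exact prod_eq_zero (mem_univ i) (by simp [hx])
    simp only [cosetPoints, Sum.elim_inl]
    rw [h0, zero_mul, add_zero, eval_derivative_prod_X_pow_sub_C (fun i => α i ^ e) hx,
      Polynomial.eval_prod]
    simp only [map_mul, map_pow, map_prod, hχe, hχζ, hχα, one_pow, mul_one, one_mul,
      Polynomial.eval_sub, Polynomial.eval_pow, Polynomial.eval_X, Polynomial.eval_C]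
    rw [prod_eq_one fun j hj => hαα i j (ne_of_mem_erase hj).symm,
      prod_eq_one fun j _ => hαβ i k j, one_mul]
  · have hx : (ξ ^ (k : ℕ) * β j) ^ f = β j ^ f := by
      rw [mul_pow, pow_right_comm, hξ.pow_eq_one, one_pow, one_mul]
    have h0 : (∏ i, (Polynomial.X ^ f - Polynomial.C (β i ^ f))).eval (ξ ^ (k : ℕ) * β j) = 0 := by
      rw [Polynomial.eval_prod]
      exact prod_eq_zero (mem_univ j) (by simp [hx])
    simp only [cosetPoints, Sum.elim_inr]
    rw [h0, mul_zero, zero_add, eval_derivative_prod_X_pow_sub_C (fun i => β i ^ f) hx,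
      Polynomial.eval_prod]
    simp only [map_mul, map_pow, map_prod, hχf, hχξ, hχβ, one_pow, one_mul,
      Polynomial.eval_sub, Polynomial.eval_pow, Polynomial.eval_X, Polynomial.eval_C]
    rw [prod_eq_one fun i hi => hββ j i (ne_of_mem_erase hi).symm,
      prod_congr rfl fun i _ => hβα j k i, prod_const, card_univ, Fintype.card_fin, hs.neg_one_pow,
      (Nat.Even.sub_odd hf hfeven odd_one).neg_one_pow]
    norm_num

theorem quadraticChar_eq_of_pow [Fintype F] [DecidableEq F] {h m : ℕ}
    (hcard : Fintype.card F = 2 * h + 1) (hm : m = h) {z : F} {ε : ℤ}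
    (hε : ε = 1 ∨ ε = -1) (hz : z ^ m = ε) : quadraticChar F z = ε := by
  subst hm
  have h2 : ringChar F ≠ 2 := fun hc => by
    have := FiniteField.even_card_iff_char_two.1 hc
    omega
  have hne : (-1 : F) ≠ 1 := Ring.neg_one_ne_one_of_char_ne_two h2
  have hz0 : z ≠ 0 := by
    rintro rfl
    have := Fintype.one_lt_card (α := F)
    rw [zero_pow (by omega)] at hz
    rcases hε with rfl | rfl <;> simp at hz
  rw [quadraticChar_eq_pow_of_char_ne_two h2 hz0, show Fintype.card F / 2 = m by omega, hz]
  rcases hε with rfl | rfl <;> simp [hne]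

section Frobenius

variable [Fintype F] [DecidableEq F] {m : ℕ} {φ : F →+* F}

theorem quadraticChar_eq_one_of_map_eq (hcard : Fintype.card F = (4 * m + 3) ^ 2)
    (hφ : ∀ x, φ x = x ^ (4 * m + 3)) {z : F} (hz0 : z ≠ 0) (hz : φ z = z) :
    quadraticChar F z = 1 := by
  have h1 : z ^ (4 * m + 2) = 1 := by
    refine mul_right_cancel₀ hz0 ?_
    rw [← pow_succ, one_mul, ← hφ, hz]
  refine quadraticChar_eq_of_pow (h := (4 * m + 2) * (2 * m + 2)) (by rw [hcard]; ring) rfl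
    (Or.inl rfl) ?_
  rw [pow_mul, h1, one_pow, Int.cast_one]

/-- The quadratic character of a difference of two elements of norm one to the subfield of
order `4 * m + 3`. -/
theorem quadraticChar_sub_eq (hcard : Fintype.card F = (4 * m + 3) ^ 2)
    (hφ : ∀ x, φ x = x ^ (4 * m + 3)) {x y : F} (hxy : x ≠ y)
    (hx : x ^ (4 * m + 4) = 1) (hy : y ^ (4 * m + 4) = 1) {ε : ℤ} (hε : ε = 1 ∨ ε = -1)
    (h : (x * y) ^ (2 * m + 2) = ε) : quadraticChar F (x - y) = ε := by
  have h1 : (x - y) ^ (4 * m + 2) * (x * y) = -1 := by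
    refine mul_right_cancel₀ (sub_ne_zero.2 hxy) ?_
    have h2 : (x - y) ^ (4 * m + 3) = x ^ (4 * m + 3) - y ^ (4 * m + 3) := by
      rw [← hφ, map_sub, hφ, hφ]
    calc _ = (x - y) ^ (4 * m + 3) * (x * y) := by ring
      _ = x ^ (4 * m + 4) * y - y ^ (4 * m + 4) * x := by rw [h2]; ring
      _ = _ := by rw [hx, hy]; ring
  have h3 : (x - y) ^ ((4 * m + 2) * (2 * m + 2)) * ε = 1 := by
    rw [← h, pow_mul, ← mul_pow, h1]
    exact Even.neg_one_pow ⟨m + 1, by ring⟩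
  refine quadraticChar_eq_of_pow (h := (4 * m + 2) * (2 * m + 2)) (by rw [hcard]; ring) rfl hε ?_
  rcases hε with rfl | rfl
  · simpa using h3
  · push_cast at h3 ⊢
    linear_combination -h3

theorem quadraticChar_natCast_eq_one (hcard : Fintype.card F = (4 * m + 3) ^ 2)
    (hφ : ∀ x, φ x = x ^ (4 * m + 3)) {a e : ℕ} (hae : a * e + 1 = Fintype.card F) :
    quadraticChar F (e : F) = 1 := by
  refine quadraticChar_eq_one_of_map_eq hcard hφ ?_ (map_natCast φ e)
  intro he
  have := congrArg (Nat.cast (R := F)) hae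
  simp [he] at this

end Frobenius

theorem exists_isPrimitiveRoot_card_sub_one (F : Type*) [Field F] [Fintype F] :
    ∃ θ : F, IsPrimitiveRoot θ (Fintype.card F - 1) := by
  classical
  obtain ⟨g, hg⟩ := IsCyclic.exists_ofOrder_eq_natCard (α := Fˣ)
  rw [Nat.card_eq_fintype_card, Fintype.card_units] at hg
  exact ⟨g, IsPrimitiveRoot.coe_units_iff.2 (hg ▸ IsPrimitiveRoot.orderOf g)⟩

theorem IsPrimitiveRoot.eq_of_pow_mul_eq {θ : F} {a b e : ℕ} (hθ : IsPrimitiveRoot θ (a * e))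
    (hb : 0 < b) (he : 0 < e) {i j : ℕ} (hi : i < a / a.gcd b) (hj : j < a / a.gcd b)
    (h : θ ^ (b * e * i) = θ ^ (b * e * j)) : i = j := by
  have hord : IsPrimitiveRoot (θ ^ (b * e)) (a / a.gcd b) := by
    have := IsPrimitiveRoot.orderOf (θ ^ (b * e))
    rwa [orderOf_pow' _ (Nat.mul_pos hb he).ne', ← hθ.eq_orderOf, Nat.gcd_mul_right,
      Nat.mul_div_mul_right _ _ he] at this
  exact hord.pow_inj hi hj (by rwa [← pow_mul, ← pow_mul])

/-- The construction with `r = 4 * m + 3`, index parameters `2 * a` and `2 * b`. -/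
theorem exists_selfDual_of_card [Fintype F] {m a b e f k l s t : ℕ} {φ : F →+* F}
    (hcard : Fintype.card F = (4 * m + 3) ^ 2) (hφ : ∀ x, φ x = x ^ (4 * m + 3))
    (hae : a * e = (2 * m + 1) * (4 * m + 4)) (hbf : b * f = (2 * m + 1) * (4 * m + 4))
    (hb : Odd b) (hk : b * (2 * m + 2) = a * k) (hl : a * (2 * m + 1) = b * l)
    (hk_odd : Odd k) (hs_odd : Odd s)
    (hs : s ≤ 2 * a / (2 * a).gcd (2 * b)) (ht : t ≤ 2 * b / (2 * b).gcd (2 * a)) :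
    ∃ C : Submodule F (Fin (s * e + t * f) → F),
      IsMDSCode C ((s * e + t * f) / 2) ∧ C = dualCode C := by
  classical
  set H := (4 * m + 2) * (2 * m + 2) with hH
  have hcard' : Fintype.card F = 2 * H + 1 := by rw [hcard, hH]; ring
  have haH : a * e = H := by rw [hae, hH]; ring
  have hbH : b * f = H := by rw [hbf, hH]; ring
  have hH0 : 0 < H := by positivity
  have ha0 : 0 < a := Nat.pos_of_mul_pos_right (haH ▸ hH0)
  have he0 : 0 < e := Nat.pos_of_mul_pos_left (haH ▸ hH0)
  have hb0 : 0 < b := Nat.pos_of_mul_pos_right (hbH ▸ hH0)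
  have hf0 : 0 < f := Nat.pos_of_mul_pos_left (hbH ▸ hH0)
  have hbe : b * e = (4 * m + 2) * k := by
    refine Nat.eq_of_mul_eq_mul_left ha0 ?_
    linear_combination b * hae + (4 * m + 2) * hk
  have haf : a * f = (4 * m + 4) * l := by
    refine Nat.eq_of_mul_eq_mul_left hb0 ?_
    linear_combination a * hbf + (4 * m + 4) * hl
  have hee : Even e := by
    have : Even (b * e) := hbe ▸ ⟨(2 * m + 1) * k, by ring⟩
    exact (Nat.even_mul.1 this).resolve_left (Nat.not_even_iff_odd.2 hb)
  have hfe : Even f := by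
    have : Even (b * f) := hbH ▸ ⟨(2 * m + 1) * (2 * m + 2), by rw [hH]; ring⟩
    exact (Nat.even_mul.1 this).resolve_left (Nat.not_even_iff_odd.2 hb)
  obtain ⟨θ, hθ⟩ := exists_isPrimitiveRoot_card_sub_one F
  rw [hcard', Nat.add_sub_cancel] at hθ
  have hneg1 : θ ^ H = -1 := IsPrimitiveRoot.eq_neg_one_of_two_right
    (hθ.pow (by positivity) (mul_comm 2 H))
  have hne : (-1 : F) ≠ 1 := fun h =>
    (hθ.pow_ne_one_of_pos_of_lt hH0.ne' (by omega)) (hneg1.trans h)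
  have hone : ∀ {n} c, n = H * (2 * c) → θ ^ n = 1 := by
    rintro n c rfl
    rw [pow_mul, hneg1, pow_mul, neg_one_sq, one_pow]
  have hodd : ∀ {n} c, n = H * c → Odd c → θ ^ n = -1 := by
    rintro n c rfl hc
    rw [pow_mul, hneg1, hc.neg_one_pow]
  have hθ0 : θ ≠ 0 := hθ.ne_zero (by positivity)
  have hχθ : quadraticChar F θ = -1 :=
    quadraticChar_eq_of_pow hcard' rfl (Or.inr rfl) (by simpa using hneg1)
  have hχeven : ∀ n, quadraticChar F (θ ^ (2 * n)) = 1 := fun n => by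
    rw [map_pow, hχθ, pow_mul, neg_one_sq, one_pow]
  have hαe : ∀ i : ℕ, (θ ^ (2 * (b * i))) ^ e = θ ^ (2 * b * e * i) := fun i => by
    rw [← pow_mul]; ring_nf
  have hβf : ∀ j : ℕ, (θ ^ (2 * (a * j) + b)) ^ f = -θ ^ (2 * a * f * j) := fun j => by
    rw [← pow_mul, show (2 * (a * j) + b) * f = 2 * a * f * j + b * f by ring, pow_add, hbH,
      hneg1, mul_neg_one]
  have hfix : ∀ j : ℕ, φ (θ ^ (2 * a * f * j)) = θ ^ (2 * a * f * j) := fun j => by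
    have h1 : (θ ^ (2 * a * f * j)) ^ (4 * m + 2) = 1 := by
      rw [← pow_mul]
      exact hone (2 * (l * j)) (by rw [hH]; linear_combination 2 * j * (4 * m + 2) * haf)
    rw [hφ, pow_succ, h1, one_mul]
  refine exists_selfDual_of_cosets (hθ.pow (by positivity) (?_ : 2 * H = 2 * a * e))
    (hθ.pow (by positivity) (?_ : 2 * H = 2 * b * f)) he0 hf0 hee hfe hs_odd
    (fun i => θ ^ (2 * (b * i))) (fun j => θ ^ (2 * (a * j) + b))
    (quadraticChar_natCast_eq_one hcard hφ (a := 2 * a) ?_)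
    (quadraticChar_natCast_eq_one hcard hφ (a := 2 * b) ?_) (hχeven a) (hχeven b)
    (fun i => hχeven _) (fun j => ?_) (fun i j hij => ?_) (fun i j hij => ?_) (fun i n j => ?_)
    (fun j n i => ?_)
  · rw [← haH]; ring
  · rw [← hbH]; ring
  · rw [hcard', ← haH]; ring
  · rw [hcard', ← hbH]; ring
  · rw [pow_add, map_mul, hχeven, one_mul, map_pow, hχθ, hb.neg_one_pow]
  · simp only [hαe]
    refine quadraticChar_sub_eq hcard hφ (fun h => hij (Fin.ext ?_)) ?_ ?_ (Or.inl rfl) ?_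
    · refine IsPrimitiveRoot.eq_of_pow_mul_eq (a := 2 * a) (b := 2 * b) (e := e) ?_ (by positivity)
        he0 (i.2.trans_le hs) (j.2.trans_le hs) h
      rwa [mul_assoc, haH]
    · rw [← pow_mul]
      exact hone (2 * (k * i)) (by rw [hH]; linear_combination 2 * i * (4 * m + 4) * hbe)
    · rw [← pow_mul]
      exact hone (2 * (k * j)) (by rw [hH]; linear_combination 2 * j * (4 * m + 4) * hbe)
    · rw [← pow_add, ← pow_mul, Int.cast_one]
      exact hone (k * (i + j)) (by rw [hH]; linear_combination 2 * (i + j) * (2 * m + 2) * hbe)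
  · simp only [hβf]
    refine quadraticChar_eq_one_of_map_eq hcard hφ (fun h => hij (Fin.ext ?_)) ?_
    · refine IsPrimitiveRoot.eq_of_pow_mul_eq (θ := θ) (a := 2 * b) (b := 2 * a) (e := f) ?_
        (by positivity) hf0 (i.2.trans_le ht) (j.2.trans_le ht) ?_
      · rwa [mul_assoc, hbH]
      · linear_combination -h
    · rw [map_sub, map_neg, map_neg, hfix, hfix]
  · have hx : ((θ ^ (2 * a)) ^ n * θ ^ (2 * (b * i))) ^ f = θ ^ (2 * a * f * n) := by
      have h1 : θ ^ (2 * (b * i) * f) = 1 := hone i (by linear_combination 2 * i * hbH)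
      rw [mul_pow, ← pow_mul θ _ f, h1, mul_one, ← pow_mul, ← pow_mul]
      ring_nf
    have hpow : ∀ j : ℕ, (θ ^ (2 * a * f * j)) ^ b = 1 := fun j => by
      rw [← pow_mul]
      exact hone (a * j) (by linear_combination 2 * a * j * hbH)
    simp only [hx, hβf]
    refine quadraticChar_eq_one_of_map_eq hcard hφ (fun h => hne ?_) ?_
    · have h1 := congrArg (· ^ b) (sub_eq_zero.1 h)
      simp only [hb.neg_pow, hpow] at h1
      exact h1.symm
    · rw [map_sub, map_neg, hfix, hfix]
  · have hx : ((θ ^ (2 * b)) ^ n * θ ^ (2 * (a * j) + b)) ^ e = θ ^ (b * e * (2 * n + 1)) := by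
      have h1 : θ ^ (2 * (a * j) * e) = 1 := hone j (by linear_combination 2 * (j : ℕ) * haH)
      rw [pow_add, mul_pow, mul_pow, ← pow_mul θ _ e, h1, one_mul, ← pow_mul, ← pow_mul,
        ← pow_mul, ← pow_add]
      ring_nf
    simp only [hx, hαe]
    refine quadraticChar_sub_eq hcard hφ (fun h => hne ?_) ?_ ?_ (Or.inr rfl) ?_
    · have h1 := congrArg (· ^ a) h
      simp only [← pow_mul] at h1
      rwa [hodd (b * (2 * n + 1)) (by linear_combination b * (2 * n + 1) * haH)
          (hb.mul (odd_two_mul_add_one n)),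
        hone (b * i) (by linear_combination 2 * b * (i : ℕ) * haH)] at h1
    · rw [← pow_mul]
      exact hone (k * (2 * n + 1))
        (by rw [hH]; linear_combination (2 * n + 1) * (4 * m + 4) * hbe)
    · rw [← pow_mul]
      exact hone (2 * (k * i)) (by rw [hH]; linear_combination 2 * i * (4 * m + 4) * hbe)
    · rw [← pow_add, ← pow_mul, Int.cast_neg, Int.cast_one]
      exact hodd (k * (2 * (n + i) + 1))
        (by rw [hH]; linear_combination (2 * (n + i) + 1) * (2 * m + 2) * hbe)
        (hk_odd.mul (odd_two_mul_add_one _))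

/-- Theorem 2(i): `q = r²`, `r ≡ 3 (mod 4)`, `a, b` even divisors of `q-1`, `b ≡ 2 (mod 4)`,
`2a ∣ b(r+1)`, `2b ∣ a(r-1)`, `1 ≤ s ≤ a/gcd(a,b)`, `1 ≤ t ≤ b/gcd(a,b)`, and
`(r+1)bs²/(2a)` odd: there exists a `q`-ary MDS Euclidean self-dual code of length
`n = s(q-1)/a + t(q-1)/b`. -/
theorem stmt14 {F : Type*} [Field F] [Fintype F] {q r : ℕ} (hq : Fintype.card F = q)
    (hq2 : q = r ^ 2) (hpp : IsPrimePow r) (hr4 : r % 4 = 3)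
    {a b : ℕ} (hae : Even a) (hbe : Even b) (ha : a ∣ q - 1) (hb : b ∣ q - 1)
    (hb4 : b % 4 = 2) (hab : 2 * a ∣ b * (r + 1)) (hba : 2 * b ∣ a * (r - 1))
    {s t : ℕ} (hs1 : 1 ≤ s) (hs2 : s ≤ a / Nat.gcd a b)
    (ht1 : 1 ≤ t) (ht2 : t ≤ b / Nat.gcd a b)
    (hodd : Odd ((r + 1) * b * s ^ 2 / (2 * a))) :
    ∃ C : Submodule F (Fin (s * ((q - 1) / a) + t * ((q - 1) / b)) → F),
      IsMDSCode C ((s * ((q - 1) / a) + t * ((q - 1) / b)) / 2) ∧ C = dualCode C := by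
  obtain ⟨a, rfl⟩ := hae.two_dvd
  obtain ⟨b, rfl⟩ := hbe.two_dvd
  obtain ⟨e, he⟩ := ha
  obtain ⟨f, hf⟩ := hb
  obtain ⟨k, hk⟩ := hab
  obtain ⟨l, hl⟩ := hba
  obtain ⟨m, rfl⟩ : ∃ m, r = 4 * m + 3 := ⟨r / 4, by omega⟩
  subst hq2
  have hq1 : (4 * m + 3) ^ 2 - 1 = 4 * ((2 * m + 1) * (2 * m + 2)) :=
    Nat.sub_eq_of_eq_add (by ring)
  have hpos : 0 < (4 * m + 3) ^ 2 - 1 := by rw [hq1]; positivity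
  have ha0 : 0 < 2 * a := Nat.pos_of_mul_pos_right (he ▸ hpos)
  have hb0 : 0 < 2 * b := Nat.pos_of_mul_pos_right (hf ▸ hpos)
  have hks : (4 * m + 3 + 1) * (2 * b) * s ^ 2 / (2 * (2 * a)) = k * s ^ 2 := by
    rw [mul_comm _ (2 * b), hk, mul_assoc]
    exact Nat.mul_div_cancel_left _ (by positivity)
  rw [hks, Nat.odd_mul] at hodd
  rw [Nat.div_eq_of_eq_mul_right ha0 he, Nat.div_eq_of_eq_mul_right hb0 hf]
  obtain ⟨p, d, hp, hd, hpd⟩ := hpp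
  have : Fact p.Prime := ⟨hp.nat_prime⟩
  have : CharP F p := by
    obtain ⟨p', hp'⟩ := CharP.exists F
    have hp'p := CharP.char_is_prime F p'
    obtain ⟨n, -, hn⟩ := FiniteField.card F p'
    have hdvd : p' ∣ p ^ (d * 2) := by
      rw [pow_mul, hpd, ← hq, hn]
      exact dvd_pow_self _ n.ne_zero
    rwa [← (Nat.prime_dvd_prime_iff_eq hp'p hp.nat_prime).1 (hp'p.dvd_of_dvd_pow hdvd)]
  rw [show 4 * m + 3 - 1 = 4 * m + 2 from rfl] at hl
  refine exists_selfDual_of_card (a := a) (b := b) (k := k) (l := l) (φ := iterateFrobenius F p d)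
    hq (fun x => ?_) ?_ ?_ (Nat.odd_iff.2 (by omega)) ?_ ?_ hodd.1
    ((Nat.odd_pow_iff two_ne_zero).1 hodd.2) hs2 (by rwa [Nat.gcd_comm])
  · rw [iterateFrobenius_def, hpd]
  · linarith
  · linarith
  · linarith
  · linarith
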